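/- For all x, y ∈ G and c ∈ ℝ⟨⟨X⟩⟩, the componentwise composition product respects the group structure (G, ⊙) in its left argument: (x ⊙ y) ∘̄ c = (x ∘̄ c) ⊙ (y ∘̄ c), and e ∘̄ c = e, where e = (𝟙, 0). -/

import Mathlib

open scoped Classical

/-!  Common setup: noncommutative formal power series ℝ⟨⟨X⟩⟩ over the
alphabet X = {x₀, x₁}.  Words are encoded as lists over `Fin 2`
(the letter `0` is x₀ and `1` is x₁); a series is a function from words
to ℝ, recording its coefficients. -/

/-- Words over the alphabet X = {x₀, x₁}. -/
abbrev Word : Type := List (Fin 2)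

/-- Noncommutative formal power series ℝ⟨⟨X⟩⟩. -/
abbrev Ser : Type := Word → ℝ

/-- The series 𝟙 (the empty word). -/
def one1 : Ser := fun w => if w = [] then 1 else 0

/-- A single word η regarded as a series. -/
def mono (η : Word) : Ser := fun w => if w = η then 1 else 0

/-- Left concatenation of a series by the letter `x_i`. -/
def lc (i : Fin 2) (c : Ser) : Ser := fun w =>
  match w with
  | [] => 0
  | j :: u => if j = i then c u else 0

/-- Auxiliary recursion computing the coefficient of a word `w` in `c ⧢ d`:
`(c ⧢ d)(𝟙) = c(𝟙) d(𝟙)` and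
`(c ⧢ d)(x_i w) = ((x_i⁻¹ c) ⧢ d)(w) + (c ⧢ (x_i⁻¹ d))(w)`,
where `x_i⁻¹` is the left shift.  This dual recursion is exactly the
bilinear extension of the inductive shuffle of words
`(x_i ξ) ⧢ (x_j η) = x_i (ξ ⧢ x_j η) + x_j (x_i ξ ⧢ η)`, `𝟙 ⧢ η = η ⧢ 𝟙 = η`. -/
def shAux : Word → Ser → Ser → ℝ
  | [], c, d => c [] * d []
  | i :: w, c, d => shAux w (fun u => c (i :: u)) d + shAux w c (fun u => d (i :: u))

/-- The shuffle product `⧢` on ℝ⟨⟨X⟩⟩. -/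
def sh (c d : Ser) : Ser := fun w => shAux w c d

/-- Shuffle powers `c^{⧢ k}`. -/
def shPow (c : Ser) : ℕ → Ser
  | 0 => one1
  | k + 1 => sh c (shPow c k)

/-- The shuffle inverse `c^{⧢ -1} = Σ_{k ≥ 0} (𝟙 - c)^{⧢ k}`.
When `c(𝟙) = 1` the sum is locally finite (for each word only finitely many
terms are nonzero) and `∑'` returns it. -/
noncomputable def shInv (c : Ser) : Ser := fun w => ∑' k : ℕ, shPow (one1 - c) k w

/-- Composition product restricted to words: `𝟙 ∘ d = 𝟙`,
`(x₀ η) ∘ d = x₀ (η ∘ d)`, `(x₁ η) ∘ d = x₀ (d ⧢ (η ∘ d))`. -/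
def wordComp : Word → Ser → Ser
  | [], _ => one1
  | i :: η, d => if i = 0 then lc 0 (wordComp η d) else lc 0 (sh d (wordComp η d))

/-- The composition product `c ∘ d = Σ_η c(η) (η ∘ d)`.  For each fixed word
only finitely many terms are nonzero, and `∑'` returns the sum. -/
noncomputable def comp (c d : Ser) : Ser := fun w => ∑' η : Word, c η * wordComp η d w

/-- Membership in the set `G`: pairs `(d₁, d₂)` with `d₁(𝟙) = 1`. -/
def inG (d : Ser × Ser) : Prop := d.1 [] = 1

/-- Mixed composition product restricted to words: `𝟙 ◁ d = 𝟙`,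
`(x₀ η) ◁ d = x₀ (η ◁ d)`,
`(x₁ η) ◁ d = x₁ (d₁ ⧢ (η ◁ d)) + x₀ (d₂ ⧢ (η ◁ d))`. -/
def wordMComp : Word → Ser × Ser → Ser
  | [], _ => one1
  | i :: η, d =>
      if i = 0 then lc 0 (wordMComp η d)
      else lc 1 (sh d.1 (wordMComp η d)) + lc 0 (sh d.2 (wordMComp η d))

/-- The mixed composition product `c ◁ d = Σ_η c(η) (η ◁ d)`. -/
noncomputable def mcomp (c : Ser) (d : Ser × Ser) : Ser :=
  fun w => ∑' η : Word, c η * wordMComp η d w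

/-- Componentwise mixed composition `c ⊲ d = (c₁ ◁ d, c₂ ◁ d)`. -/
noncomputable def tri (c d : Ser × Ser) : Ser × Ser := (mcomp c.1 d, mcomp c.2 d)

/-- Componentwise composition `d ∘̄ c = (d₁ ∘ c, d₂ ∘ c)`. -/
noncomputable def bcomp (d : Ser × Ser) (c : Ser) : Ser × Ser := (comp d.1 c, comp d.2 c)

/-- The group product `⊙` on `G`:
`(c₁, c₂) ⊙ (d₁, d₂) = (c₁ ⧢ d₁, c₂ + d₂ ⧢ c₁)`. -/
def odot (c d : Ser × Ser) : Ser × Ser := (sh c.1 d.1, c.2 + sh d.2 c.1)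

/-- The identity element `e = (𝟙, 0)`. -/
def eG : Ser × Ser := (one1, 0)

/-- The `⊙`-inverse `c^{⊙ -1} = (c₁^{⧢ -1}, -(c₁^{⧢ -1} ⧢ c₂))`. -/
noncomputable def odotInv (c : Ser × Ser) : Ser × Ser :=
  (shInv c.1, -(sh (shInv c.1) c.2))

/-- The affine feedback group product `c ⋆ d = (c ⊲ d) ⊙ d` on `G`. -/
noncomputable def star (c d : Ser × Ser) : Ser × Ser := odot (tri c d) d

/-- The `⋆`-inverse of an element of `G` (defined via choice; for an element
of the group `(G, ⋆)` it is the unique two-sided `⋆`-inverse). -/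
noncomputable def starInv (x : Ser × Ser) : Ser × Ser :=
  if h : ∃ y : Ser × Ser, inG y ∧ star x y = eG ∧ star y x = eG then h.choose else x

/-- The affine feedback product `c @ d = c ◁ ((d^{⊙ -1}) ∘̄ c)^{⋆ -1}`. -/
noncomputable def atp (c : Ser) (d : Ser × Ser) : Ser :=
  mcomp c (starInv (bcomp (odotInv d) c))

/-- Membership in ℝ[[x₀]]: series vanishing on every word containing x₁. -/
def inRx0 (c : Ser) : Prop := ∀ w : Word, (1 : Fin 2) ∈ w → c w = 0

/-- Left shift `x_i⁻¹ c` of a series by the letter `x_i`. -/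
def leftShift (i : Fin 2) (c : Ser) : Ser := fun u => c (i :: u)

theorem sh_nil (c d : Ser) : sh c d [] = c [] * d [] := rfl

theorem sh_cons (c d : Ser) (i : Fin 2) (w : Word) :
    sh c d (i :: w) = sh (leftShift i c) d w + sh c (leftShift i d) w := rfl

theorem leftShift_sh (c d : Ser) (i : Fin 2) :
    leftShift i (sh c d) = sh (leftShift i c) d + sh c (leftShift i d) := rfl

theorem leftShift_add (c d : Ser) (i : Fin 2) :
    leftShift i (c + d) = leftShift i c + leftShift i d := rfl

theorem leftShift_smul (r : ℝ) (c : Ser) (i : Fin 2) :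
    leftShift i (r • c) = r • leftShift i c := rfl

theorem sh_comm (c d : Ser) : sh c d = sh d c := by
  funext w
  induction w generalizing c d with
  | nil => simp only [sh_nil, mul_comm]
  | cons i w ih => rw [sh_cons, sh_cons, ih, ih c, add_comm]

theorem sh_add (c d e : Ser) : sh c (d + e) = sh c d + sh c e := by
  funext w
  induction w generalizing c d e with
  | nil => simp only [sh_nil, Pi.add_apply, mul_add]
  | cons i w ih =>
    simp only [sh_cons, leftShift_add, ih, Pi.add_apply]
    ring

theorem add_sh (c d e : Ser) : sh (c + d) e = sh c e + sh d e := by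
  rw [sh_comm, sh_add, sh_comm e, sh_comm e]

theorem sh_smul (r : ℝ) (c d : Ser) : sh c (r • d) = r • sh c d := by
  funext w
  induction w generalizing c d with
  | nil => simp only [sh_nil, Pi.smul_apply, smul_eq_mul]; ring
  | cons i w ih =>
    simp only [sh_cons, leftShift_smul, ih, Pi.smul_apply, smul_eq_mul]
    ring

theorem sh_zero (c : Ser) : sh c 0 = 0 := by
  simpa using sh_smul 0 c 0

theorem sh_sum {ι : Type*} (c : Ser) (s : Finset ι) (f : ι → Ser) :
    sh c (∑ i ∈ s, f i) = ∑ i ∈ s, sh c (f i) := by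
  induction s using Finset.induction_on with
  | empty => simp only [Finset.sum_empty, sh_zero]
  | insert a s ha ih => rw [Finset.sum_insert ha, Finset.sum_insert ha, sh_add, ih]

theorem sh_assoc (c d e : Ser) : sh (sh c d) e = sh c (sh d e) := by
  funext w
  induction w generalizing c d e with
  | nil => simp only [sh_nil, mul_assoc]
  | cons i w ih =>
    simp only [sh_cons, leftShift_sh, add_sh, sh_add, Pi.add_apply, ih, add_assoc]

/-- The coefficient of `c ⧢ d` at `w` depends only on the coefficients of `d` at words
no longer than `w`. -/
theorem sh_congr_of_length_le {c d e : Ser} {w : Word}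
    (h : ∀ u : Word, u.length ≤ w.length → d u = e u) : sh c d w = sh c e w := by
  induction w generalizing c d e with
  | nil => rw [sh_nil, sh_nil, h [] le_rfl]
  | cons i w ih =>
    rw [sh_cons, sh_cons, ih fun u hu => h u (hu.trans (by simp)),
      ih (d := leftShift i d) (e := leftShift i e) fun u hu => h (i :: u) (by simpa using hu)]

theorem wordComp_eq_zero_of_length_lt {η w : Word} (d : Ser) (h : w.length < η.length) :
    wordComp η d w = 0 := by
  induction η generalizing w with
  | nil => simp at h
  | cons i η ih =>
    cases w with
    | nil => fin_cases i <;> rfl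
    | cons j w =>
      have hw : w.length < η.length := by simpa using h
      have hs : sh d (wordComp η d) w = 0 := by
        rw [sh_congr_of_length_le (e := 0) fun u hu => ih (hu.trans_lt hw), sh_zero]
        rfl
      fin_cases i <;> simp [wordComp, lc, ih hw, hs]

theorem wordComp_cons_nil (i : Fin 2) (η : Word) (d : Ser) : wordComp (i :: η) d [] = 0 :=
  wordComp_eq_zero_of_length_lt d (by simp)

theorem wordComp_one_letter_cons (η : Word) (d : Ser) (w : Word) :
    wordComp η d (1 :: w) = 0 := by
  cases η with
  | nil => simp [wordComp, one1]
  | cons i η => fin_cases i <;> simp [wordComp, lc]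

/-- The words of length at most `n`. -/
noncomputable def wordsLE (n : ℕ) : Finset Word := (List.finite_length_le (Fin 2) n).toFinset

theorem mem_wordsLE {n : ℕ} {η : Word} : η ∈ wordsLE n ↔ η.length ≤ n := by
  simp [wordsLE]

theorem mul_wordComp_eq_zero (c d : Ser) {n : ℕ} {w : Word} (hw : w.length ≤ n) (η : Word)
    (hη : η ∉ wordsLE n) : c η * wordComp η d w = 0 := by
  rw [mem_wordsLE, not_le] at hη
  rw [wordComp_eq_zero_of_length_lt d (hw.trans_lt hη), mul_zero]

theorem summable_comp (c d : Ser) (w : Word) : Summable fun η => c η * wordComp η d w :=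
  summable_of_ne_finset_zero (mul_wordComp_eq_zero c d le_rfl)

theorem comp_eq_sum (c d : Ser) {n : ℕ} {w : Word} (hw : w.length ≤ n) :
    comp c d w = ∑ η ∈ wordsLE n, c η * wordComp η d w :=
  tsum_eq_sum (mul_wordComp_eq_zero c d hw)

theorem comp_add (a b c : Ser) : comp (a + b) c = comp a c + comp b c := by
  funext w
  simp only [Pi.add_apply, comp_eq_sum _ _ (le_refl w.length), add_mul, Finset.sum_add_distrib]

theorem zero_comp (c : Ser) : comp 0 c = 0 := by
  funext w
  simp [comp]

theorem one1_comp (c : Ser) : comp one1 c = one1 := by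
  funext w
  rw [comp, tsum_eq_single []]
  · simp [one1, wordComp]
  · intro η hη
    simp [one1, hη]

theorem comp_nil (a c : Ser) : comp a c [] = a [] := by
  rw [comp, tsum_eq_single []]
  · simp [one1, wordComp]
  · intro η hη
    cases η with
    | nil => exact absurd rfl hη
    | cons i η => rw [wordComp_cons_nil, mul_zero]

theorem leftShift_one_comp (a c : Ser) : leftShift 1 (comp a c) = 0 := by
  funext w
  simp [leftShift, comp, wordComp_one_letter_cons]

theorem sh_comp_apply (a c : Ser) (w : Word) :
    sh c (comp a c) w = ∑' η, a η * sh c (wordComp η c) w := by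
  rw [sh_congr_of_length_le (e := ∑ η ∈ wordsLE w.length, a η • wordComp η c), sh_sum,
    Finset.sum_apply, tsum_eq_sum (s := wordsLE w.length)]
  · simp only [sh_smul, Pi.smul_apply, smul_eq_mul]
  · intro η hη
    rw [mem_wordsLE, not_le] at hη
    rw [sh_congr_of_length_le (e := 0) fun u hu =>
      wordComp_eq_zero_of_length_lt c (hu.trans_lt hη), sh_zero, Pi.zero_apply, mul_zero]
  · intro u hu
    simp [comp_eq_sum a c hu]

/-- Splitting a sum over words according to their first letter. -/
theorem tsum_word {f : Word → ℝ} (hf : Summable f) :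
    ∑' η, f η = f [] + (∑' η, f (0 :: η) + ∑' η, f (1 :: η)) := by
  let e : Unit ⊕ (Word ⊕ Word) ≃ Word :=
    { toFun := Sum.elim (fun _ => []) (Sum.elim (List.cons 0) (List.cons 1))
      invFun := fun w => match w with
        | [] => Sum.inl ()
        | i :: u => Sum.inr (if i = 0 then Sum.inl u else Sum.inr u)
      left_inv := by rintro (_ | _ | _) <;> simp
      right_inv := by
        rintro (_ | ⟨i, u⟩)
        · rfl
        · fin_cases i <;> rfl }
  have hcons : ∀ i : Fin 2, Summable fun η => f (i :: η) := fun i =>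
    hf.comp_injective List.cons_injective
  exact (e.hasSum_iff.mp (((hasSum_unique _).sum
    ((hcons 0).hasSum.sum (hcons 1).hasSum : HasSum ((f ∘ e) ∘ Sum.inr) _) :
      HasSum (f ∘ e) _))).tsum_eq

theorem leftShift_zero_comp (a c : Ser) :
    leftShift 0 (comp a c) = comp (leftShift 0 a) c + sh c (comp (leftShift 1 a) c) := by
  funext w
  rw [Pi.add_apply, sh_comp_apply, leftShift, comp, tsum_word (summable_comp a c _)]
  simp [wordComp, one1, lc, comp, leftShift]

theorem comp_sh (a b c : Ser) : comp (sh a b) c = sh (comp a c) (comp b c) := by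
  funext w
  induction hn : w.length using Nat.strong_induction_on generalizing a b w with
  | _ n ih =>
    subst hn
    cases w with
    | nil => simp only [sh_nil, comp_nil]
    | cons i w =>
      have ih' : ∀ (a b : Ser) (u : Word), u.length ≤ w.length →
          comp (sh a b) c u = sh (comp a c) (comp b c) u := fun a b u hu =>
        ih u.length (by simpa using Nat.lt_succ_of_le hu) a b u rfl
      have hs : ∀ a b : Ser, sh c (comp (sh a b) c) w = sh c (sh (comp a c) (comp b c)) w :=
        fun a b => sh_congr_of_length_le (ih' a b)
      change leftShift i (comp (sh a b) c) w = _
      rw [sh_cons]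
      fin_cases i
      · simp only [Fin.zero_eta, leftShift_zero_comp, leftShift_sh, comp_add, sh_add, add_sh,
          Pi.add_apply, hs, ih' _ _ w le_rfl, sh_assoc]
        rw [← sh_assoc (comp a c) c, sh_comm (comp a c) c, sh_assoc]
        ring
      · simp [leftShift_one_comp, sh_zero, sh_comm 0]

/-- the componentwise composition product respects the group
structure `(G, ⊙)` in its left argument:
`(x ⊙ y) ∘̄ c = (x ∘̄ c) ⊙ (y ∘̄ c)` and `e ∘̄ c = e`. -/
theorem bcomp_respects_odot (x y : Ser × Ser) (c : Ser)
    (hx : inG x) (hy : inG y) :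
    bcomp (odot x y) c = odot (bcomp x c) (bcomp y c) ∧ bcomp eG c = eG := by
  constructor
  · simp only [bcomp, odot, comp_add, comp_sh]
  · simp only [bcomp, eG, one1_comp, zero_comp]
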